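/- There exists no PMF p on {0,1}⁴ such that the marginal of p on the first three coordinates is the uniform PMF on {0,1}³ and, for every i ∈ {1,2,3}, the marginal of p on coordinates (i,4) is the PMF with mass 1/2 at (0,0), 0 at (0,1), 1/4 at (1,0), 1/4 at (1,1). -/

import Mathlib

open scoped Classical

noncomputable section

/-- A probability mass function on a finite type: nonnegative and summing to one. -/
def IsPMF {α : Type*} [Fintype α] (p : α → ℝ) : Prop :=
  (∀ x, 0 ≤ p x) ∧ ∑ x, p x = 1

/-- Shannon entropy in bits, with the convention `0 · log₂ 0 = 0`. -/
def Ent {α : Type*} [Fintype α] (p : α → ℝ) : ℝ :=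
  -∑ x, p x * Real.logb 2 (p x)

/-- Pushforward of a mass function along a map. -/
def push {α β : Type*} [Fintype α] (f : α → β) (p : α → ℝ) : β → ℝ :=
  fun b => ∑ a ∈ Finset.univ.filter (fun a => f a = b), p a

/-- Tuples indexed by a finite subset `A` of the coordinates. -/
abbrev Vec {N : ℕ} (X : Fin N → Type) (A : Finset (Fin N)) : Type :=
  ∀ i : {i // i ∈ A}, X i.1

section

variable {N : ℕ} {X : Fin N → Type} [∀ i, Fintype (X i)]

/-- Restriction of a tuple on coordinates `A` to a smaller subset `B ⊆ A`. -/
def restr {A B : Finset (Fin N)} (h : B ⊆ A) (x : Vec X A) : Vec X B :=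
  fun i => x ⟨i.1, h i.2⟩

/-- Marginal of a mass function on coordinates `A` onto `B ⊆ A`. -/
def marg {A B : Finset (Fin N)} (p : Vec X A → ℝ) (h : B ⊆ A) : Vec X B → ℝ :=
  push (restr h) p

/-- Marginal of a mass function on all coordinates onto the subset `A`. -/
def margF (p : (∀ i, X i) → ℝ) (A : Finset (Fin N)) : Vec X A → ℝ :=
  push (fun x i => x i.1) p

/-- Single-coordinate marginal. -/
def margOne (p : (∀ i, X i) → ℝ) (i : Fin N) : X i → ℝ :=
  push (fun x => x i) p

variable {M : ℕ}

/-- The prescribed subset distributions are PMFs, consistent with each other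
(marginals agree on intersections) and with the single-coordinate marginals `P i`. -/
def Consistent (P : ∀ i, X i → ℝ) (S : Fin M → Finset (Fin N))
    (PS : ∀ j, Vec X (S j) → ℝ) : Prop :=
  (∀ i, IsPMF (P i)) ∧ (∀ j, IsPMF (PS j)) ∧
  (∀ j j', marg (PS j) (Finset.inter_subset_left : S j ∩ S j' ⊆ S j)
         = marg (PS j') (Finset.inter_subset_right : S j ∩ S j' ⊆ S j')) ∧
  (∀ j, ∀ i, ∀ h : i ∈ S j, push (fun x : Vec X (S j) => x ⟨i, h⟩) (PS j) = P i)

/-- The constrained maximum entropy `H*(𝒥)`: the supremum of entropies of PMFs on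
`∏_{i ∈ 𝒥} 𝒳_i` whose marginal on `𝒥 ∩ 𝒮_j` equals the marginal of `P_{𝒮_j}` for every `j`. -/
def Hstar (S : Fin M → Finset (Fin N)) (PS : ∀ j, Vec X (S j) → ℝ)
    (J : Finset (Fin N)) : ℝ :=
  sSup { h | ∃ q : Vec X J → ℝ, IsPMF q ∧
    (∀ j, marg q (Finset.inter_subset_left : J ∩ S j ⊆ J)
        = marg (PS j) (Finset.inter_subset_right : J ∩ S j ⊆ S j)) ∧
    h = Ent q }

end

/-- `ε`-typicality of a length-`n` sequence for a PMF `Q`. -/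
def Typical {α : Type*} [Fintype α] (n : ℕ) (ε : ℝ) (Q : α → ℝ) (x : Fin n → α) : Prop :=
  ∀ a, |((Finset.univ.filter (fun l => x l = a)).card : ℝ) / n - Q a| ≤ ε * Q a

/-- Joint `ε`-typicality, for the tuple of sequences restricted to the subset `A`,
of the induced sequence over the product alphabet. -/
def SubTyp {N : ℕ} {X : Fin N → Type} [∀ i, Fintype (X i)] (n : ℕ) (ε : ℝ)
    {A : Finset (Fin N)} (Q : Vec X A → ℝ) (x : ∀ i, Fin n → X i) : Prop :=
  Typical n ε Q (fun l (i : {i // i ∈ A}) => x i.1 l)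

/-- Probability of the event `E` when the `N` sequences of length `n` are generated
mutually independently, coordinatewise i.i.d. according to the marginals `P i`. -/
def probIID {N : ℕ} {X : Fin N → Type} [∀ i, Fintype (X i)] (P : ∀ i, X i → ℝ) (n : ℕ)
    (E : (∀ i, Fin n → X i) → Prop) : ℝ :=
  ∑ x ∈ Finset.univ.filter E, ∏ i, ∏ l, P i (x i l)

/-- `δ` is a valid correction function: positive on positive arguments and
vanishing as `ε → 0⁺`. -/
def DeltaFun (δ : ℝ → ℝ) : Prop :=
  (∀ ε, 0 < ε → 0 < δ ε) ∧ Filter.Tendsto δ (nhdsWithin 0 (Set.Ioi 0)) (nhds 0)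

end
noncomputable section

/-- The six two-element constraint subsets of the example instance
(coordinates `0,1,2,3` standing for `X₁,X₂,X₃,X₄`). -/
def Spairs : Fin 6 → Finset (Fin 4) := ![{0, 1}, {0, 2}, {1, 2}, {0, 3}, {1, 3}, {2, 3}]

/-- The marginal PMFs of the example: `X₁,X₂,X₃ ~ bern(1/2)`, `X₄ ~ bern(3/4)`
(with `false` standing for `0`). -/
def Pex : ∀ _ : Fin 4, Bool → ℝ :=
  fun i b => if i.1 < 3 then 1 / 2 else if b = false then 3 / 4 else 1 / 4

/-- The prescribed pairwise PMF of `(Xᵢ, X₄)`: mass `1/2` at `(0,0)`, `0` at `(0,1)`,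
`1/4` at `(1,0)` and `1/4` at `(1,1)`. -/
def pair14 : Bool → Bool → ℝ :=
  fun a b => if a = false then (if b = false then 1 / 2 else 0) else 1 / 4

/-- Value of a tuple `y` on subset `A` at a coordinate `i` (junk value `false` if `i ∉ A`). -/
def getB {A : Finset (Fin 4)} (y : Vec (fun _ : Fin 4 => Bool) A) (i : Fin 4) : Bool :=
  if h : i ∈ A then y ⟨i, h⟩ else false

/-- The prescribed pairwise distributions of the example instance: `(Xᵢ, Xⱼ)` is uniform on
`{0,1}²` for `i < j` in `{1,2,3}`, and `(Xᵢ, X₄)` is distributed according to `pair14`. -/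
def PSex (j : Fin 6) : Vec (fun _ : Fin 4 => Bool) (Spairs j) → ℝ :=
  fun y =>
    if j.1 < 3 then 1 / 4
    else pair14 (getB y ⟨j.1 - 3, by have := j.isLt; omega⟩) (getB y 3)

/-- Binary entropy function (in bits). -/
def Hb (p : ℝ) : ℝ := -(p * Real.logb 2 p) - (1 - p) * Real.logb 2 (1 - p)

end

/-- Value of a marginal at the restriction of a full tuple `z`. -/
theorem margF_restrict {N : ℕ} {X : Fin N → Type} [∀ i, Fintype (X i)]
    (p : (∀ i, X i) → ℝ) (A : Finset (Fin N)) (z : ∀ i, X i)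
    [DecidablePred fun x : (∀ i, X i) => ∀ i ∈ A, x i = z i] :
    margF p A (fun i => z i.1) = ∑ x with ∀ i ∈ A, x i = z i, p x := by
  simp only [margF, push, funext_iff, Subtype.forall]
  congr!

theorem getB_restrict {A : Finset (Fin 4)} (z : Fin 4 → Bool) {i : Fin 4} (h : i ∈ A) :
    getB (A := A) (fun k => z k.1) i = z i := by
  simp [getB, h]

theorem no_joint_with_mutually_independent_first_three :
    ¬ ∃ p : (Fin 4 → Bool) → ℝ, IsPMF p ∧
        margF (X := fun _ : Fin 4 => Bool) p {0, 1, 2} = (fun _ => 1 / 8) ∧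
        ∀ i : Fin 4, i.1 < 3 →
          margF (X := fun _ : Fin 4 => Bool) p {i, 3} =
            fun y => pair14 (getB y i) (getB y 3) := by
  rintro ⟨p, ⟨hp, -⟩, h3, h4⟩
  have hpair (i : Fin 4) (hi : i.1 < 3) (z : Fin 4 → Bool) :
      ∑ x with ∀ k ∈ ({i, 3} : Finset (Fin 4)), x k = z k, p x = pair14 (z i) (z 3) := by
    rw [← margF_restrict (X := fun _ => Bool), h4 i hi]
    simp [getB_restrict z]
  have hzero (i : Fin 4) (hi : i.1 < 3) (x : Fin 4 → Bool) (hxi : x i = false)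
      (hx3 : x 3 = true) : p x = 0 := by
    have h := hpair i hi x
    rw [hxi, hx3] at h
    exact (Finset.sum_eq_zero_iff_of_nonneg fun y _ => hp y).1 (h.trans (by simp [pair14])) x
      (by simp)
  have htriple := margF_restrict (X := fun _ => Bool) p {0, 1, 2} fun _ => true
  rw [h3] at htriple
  have hquarter := hpair 0 (by simp) fun _ => true
  rw [← Finset.sum_filter_ne_zero] at hquarter
  have hle := Finset.sum_le_sum_of_subset_of_nonneg (f := p)
    (s := {x ∈ {x | ∀ k ∈ ({0, 3} : Finset (Fin 4)), x k = true} | p x ≠ 0})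
    (t := {x | ∀ k ∈ ({0, 1, 2} : Finset (Fin 4)), x k = true})
    (fun x hx => by
      simp only [Finset.mem_filter, Finset.mem_univ, true_and, Finset.mem_insert,
        Finset.mem_singleton, forall_eq_or_imp, forall_eq] at hx ⊢
      obtain ⟨⟨hx0, hx3⟩, hne⟩ := hx
      exact ⟨hx0, by_contra fun h => hne (hzero 1 (by simp) x (by simpa using h) hx3),
        by_contra fun h => hne (hzero 2 (by simp) x (by simpa using h) hx3)⟩)
    (fun x _ _ => hp x)
  rw [hquarter, ← htriple] at hle
  norm_num [pair14] at hle
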